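/- Witness (existence) property of CD: if the formula ∃α A is provable in CD (i.e. there is a closed proof term t with CD ⊢ t : ∃α A), then there exists a term m of the first-order language such that A[m/α] is provable in CD. -/

import Mathlib

/-! A Curry-Howard formalization of the intuitionistic first-order logic of
constant domains CD (Aschieri-Genco style), with de Bruijn indices both for
first-order variables and for proof-term variables. -/

/-- First-order terms: variables (de Bruijn), constants, function applications. -/
inductive Tm : Type where
  | var : ℕ → Tm
  | const : ℕ → Tm
  | func : ℕ → List Tm → Tm

namespace Tm

/-- Lift (shift by `d`) the first-order variables `≥ c`. -/
def lift (d c : ℕ) : Tm → Tm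
  | var i => if i < c then var i else var (i + d)
  | const k => const k
  | func f ts => func f (ts.attach.map fun x => lift d c x.1)
termination_by t => sizeOf t
decreasing_by have := List.sizeOf_lt_of_mem x.2; simp; omega

/-- Substitute the term `m` for the first-order variable `k` (variables `> k` are decremented). -/
def subst (k : ℕ) (m : Tm) : Tm → Tm
  | var i => if i = k then m else if i < k then var i else var (i - 1)
  | const c' => const c'
  | func f ts => func f (ts.attach.map fun x => subst k m x.1)
termination_by t => sizeOf t
decreasing_by have := List.sizeOf_lt_of_mem x.2; simp; omega

end Tm

/-- First-order formulas, with de Bruijn quantifiers. -/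
inductive Fml : Type where
  | atom : ℕ → List Tm → Fml
  | bot : Fml
  | conj : Fml → Fml → Fml
  | disj : Fml → Fml → Fml
  | impl : Fml → Fml → Fml
  | all : Fml → Fml
  | ex : Fml → Fml

namespace Fml

/-- Lift (shift by `d`) the free first-order variables `≥ c`. -/
def lift (d : ℕ) : ℕ → Fml → Fml
  | c, atom P ts => atom P (ts.map (Tm.lift d c))
  | _, bot => bot
  | c, conj A B => conj (lift d c A) (lift d c B)
  | c, disj A B => disj (lift d c A) (lift d c B)
  | c, impl A B => impl (lift d c A) (lift d c B)
  | c, all A => all (lift d (c + 1) A)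
  | c, ex A => ex (lift d (c + 1) A)

/-- Substitute the term `m` for the free first-order variable `k`. -/
def subst : ℕ → Tm → Fml → Fml
  | k, m, atom P ts => atom P (ts.map (Tm.subst k m))
  | _, _, bot => bot
  | k, m, conj A B => conj (subst k m A) (subst k m B)
  | k, m, disj A B => disj (subst k m A) (subst k m B)
  | k, m, impl A B => impl (subst k m A) (subst k m B)
  | k, m, all A => all (subst (k + 1) (m.lift 1 0) A)
  | k, m, ex A => ex (subst (k + 1) (m.lift 1 0) A)

/-- Atomic formulas (including `⊥`, a 0-ary predicate symbol). -/
def Atomic : Fml → Prop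
  | atom _ _ => True
  | bot => True
  | _ => False

end Fml

/-- Proof terms of CD. Proof-term variables are de Bruijn indices; `lam`
binds a proof variable, `qlam` binds a first-order variable, `case` binds one
proof variable in each branch, `edest` binds one first-order variable and one
proof variable in its second argument. `D A B` is the constant for the
constant-domain axiom `∀α(A ∨ B) → ∀α A ∨ B` (in de Bruijn style, `A` may
contain the bound variable `0` while `B` is a formula of the outer context,
so that "`α` does not occur in `B`" holds by construction). -/
inductive Pf : Type where
  | var : ℕ → Pf
  | pair : Pf → Pf → Pf
  | proj : Bool → Pf → Pf
  | lam : Fml → Pf → Pf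
  | app : Pf → Pf → Pf
  | inj : Bool → Pf → Pf
  | case : Pf → Pf → Pf → Pf
  | qlam : Pf → Pf
  | qapp : Pf → Tm → Pf
  | epair : Tm → Pf → Pf
  | edest : Pf → Pf → Pf
  | efq : Fml → Pf → Pf
  | D : Fml → Fml → Pf

namespace Pf

/-- Lift the free first-order variables `≥ c` by `d` in a proof term. -/
def tlift : Pf → ℕ → ℕ → Pf
  | var n, _, _ => var n
  | pair u t, d, c => pair (tlift u d c) (tlift t d c)
  | proj b u, d, c => proj b (tlift u d c)
  | lam A u, d, c => lam (A.lift d c) (tlift u d c)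
  | app u t, d, c => app (tlift u d c) (tlift t d c)
  | inj b u, d, c => inj b (tlift u d c)
  | case u w₁ w₂, d, c => case (tlift u d c) (tlift w₁ d c) (tlift w₂ d c)
  | qlam u, d, c => qlam (tlift u d (c + 1))
  | qapp u m, d, c => qapp (tlift u d c) (m.lift d c)
  | epair m u, d, c => epair (m.lift d c) (tlift u d c)
  | edest u v, d, c => edest (tlift u d c) (tlift v d (c + 1))
  | efq P u, d, c => efq (P.lift d c) (tlift u d c)
  | D A B, d, c => D (A.lift d (c + 1)) (B.lift d c)

/-- Lift the free proof-term variables `≥ c` by `d` in a proof term. -/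
def plift : Pf → ℕ → ℕ → Pf
  | var n, d, c => if n < c then var n else var (n + d)
  | pair u t, d, c => pair (plift u d c) (plift t d c)
  | proj b u, d, c => proj b (plift u d c)
  | lam A u, d, c => lam A (plift u d (c + 1))
  | app u t, d, c => app (plift u d c) (plift t d c)
  | inj b u, d, c => inj b (plift u d c)
  | case u w₁ w₂, d, c => case (plift u d c) (plift w₁ d (c + 1)) (plift w₂ d (c + 1))
  | qlam u, d, c => qlam (plift u d c)
  | qapp u m, d, c => qapp (plift u d c) m
  | epair m u, d, c => epair m (plift u d c)
  | edest u v, d, c => edest (plift u d c) (plift v d (c + 1))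
  | efq P u, d, c => efq P (plift u d c)
  | D A B, _, _ => D A B

/-- Substitute the proof term `q` for the proof variable `k` (variables `> k` decremented). -/
def psubst : Pf → ℕ → Pf → Pf
  | var n, k, q => if n = k then q else if n < k then var n else var (n - 1)
  | pair u t, k, q => pair (psubst u k q) (psubst t k q)
  | proj b u, k, q => proj b (psubst u k q)
  | lam A u, k, q => lam A (psubst u (k + 1) (plift q 1 0))
  | app u t, k, q => app (psubst u k q) (psubst t k q)
  | inj b u, k, q => inj b (psubst u k q)
  | case u w₁ w₂, k, q =>
      case (psubst u k q) (psubst w₁ (k + 1) (plift q 1 0)) (psubst w₂ (k + 1) (plift q 1 0))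
  | qlam u, k, q => qlam (psubst u k (tlift q 1 0))
  | qapp u m, k, q => qapp (psubst u k q) m
  | epair m u, k, q => epair m (psubst u k q)
  | edest u v, k, q => edest (psubst u k q) (psubst v (k + 1) (tlift (plift q 1 0) 1 0))
  | efq P u, k, q => efq P (psubst u k q)
  | D A B, _, _ => D A B

/-- Substitute the first-order term `m` for the first-order variable `k` in a proof term. -/
def tsubst : Pf → ℕ → Tm → Pf
  | var n, _, _ => var n
  | pair u t, k, m => pair (tsubst u k m) (tsubst t k m)
  | proj b u, k, m => proj b (tsubst u k m)
  | lam A u, k, m => lam (A.subst k m) (tsubst u k m)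
  | app u t, k, m => app (tsubst u k m) (tsubst t k m)
  | inj b u, k, m => inj b (tsubst u k m)
  | case u w₁ w₂, k, m => case (tsubst u k m) (tsubst w₁ k m) (tsubst w₂ k m)
  | qlam u, k, m => qlam (tsubst u (k + 1) (m.lift 1 0))
  | qapp u t, k, m => qapp (tsubst u k m) (Tm.subst k m t)
  | epair t u, k, m => epair (Tm.subst k m t) (tsubst u k m)
  | edest u v, k, m => edest (tsubst u k m) (tsubst v (k + 1) (m.lift 1 0))
  | efq P u, k, m => efq (P.subst k m) (tsubst u k m)
  | D A B, k, m => D (A.subst (k + 1) (m.lift 1 0)) (B.subst k m)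

/-- The set of free proof-term variables of a proof term. -/
def fvars : Pf → Set ℕ
  | var n => {n}
  | pair u t => fvars u ∪ fvars t
  | proj _ u => fvars u
  | lam _ u => {n | n + 1 ∈ fvars u}
  | app u t => fvars u ∪ fvars t
  | inj _ u => fvars u
  | case u w₁ w₂ => fvars u ∪ {n | n + 1 ∈ fvars w₁} ∪ {n | n + 1 ∈ fvars w₂}
  | qlam u => fvars u
  | qapp u _ => fvars u
  | epair _ u => fvars u
  | edest u v => fvars u ∪ {n | n + 1 ∈ fvars v}
  | efq _ u => fvars u
  | D _ _ => ∅

end Pf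

/-- The typing relation of CD: `Typed Γ t A` means that the proof term `t`
proves `A` from the (proof-variable) context `Γ`.  In the rules `qlam` and
`edest`, the side condition "the generalized first-order variable does not
occur in the context (resp. in the context and the conclusion)" is rendered,
de Bruijn style, by lifting. -/
inductive Typed : List Fml → Pf → Fml → Prop where
  | var {Γ n A} : Γ[n]? = some A → Typed Γ (.var n) A
  | pair {Γ u t A B} : Typed Γ u A → Typed Γ t B → Typed Γ (.pair u t) (.conj A B)
  | projL {Γ u A B} : Typed Γ u (.conj A B) → Typed Γ (.proj false u) A
  | projR {Γ u A B} : Typed Γ u (.conj A B) → Typed Γ (.proj true u) B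
  | lam {Γ u A B} : Typed (A :: Γ) u B → Typed Γ (.lam A u) (.impl A B)
  | app {Γ t u A B} : Typed Γ t (.impl A B) → Typed Γ u A → Typed Γ (.app t u) B
  | injL {Γ u A B} : Typed Γ u A → Typed Γ (.inj false u) (.disj A B)
  | injR {Γ u A B} : Typed Γ u B → Typed Γ (.inj true u) (.disj A B)
  | case {Γ u w₁ w₂ A B C} : Typed Γ u (.disj A B) → Typed (A :: Γ) w₁ C →
      Typed (B :: Γ) w₂ C → Typed Γ (.case u w₁ w₂) C
  | qlam {Γ u A} : Typed (Γ.map (Fml.lift 1 0)) u A → Typed Γ (.qlam u) (.all A)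
  | qapp {Γ u A} (m : Tm) : Typed Γ u (.all A) → Typed Γ (.qapp u m) (A.subst 0 m)
  | epair {Γ u A} (m : Tm) : Typed Γ u (A.subst 0 m) → Typed Γ (.epair m u) (.ex A)
  | edest {Γ u t A C} : Typed Γ u (.ex A) →
      Typed (A :: Γ.map (Fml.lift 1 0)) t (C.lift 1 0) → Typed Γ (.edest u t) C
  | efq {Γ u P} : Typed Γ u .bot → Fml.Atomic P → Typed Γ (.efq P u) P
  | D {Γ A B} : Typed Γ (.D A B)
      (.impl (.all (.disj A (B.lift 1 0))) (.disj (.all A) B))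

/-- The one-step reduction relation of CD: the standard intuitionistic
reductions, the two reductions for the constant-domain axiom constant `D`
(where the fixed constant `c` of the language is `Tm.const 0`), and closure
under every term context. -/
inductive Step : Pf → Pf → Prop where
  -- intuitionistic redexes
  | beta {A u t} : Step (.app (.lam A u) t) (u.psubst 0 t)
  | qbeta {u m} : Step (.qapp (.qlam u) m) (u.tsubst 0 m)
  | projPair {u₀ u₁ b} : Step (.proj b (.pair u₀ u₁)) (if b then u₁ else u₀)
  | caseInj {b u w₁ w₂} : Step (.case (.inj b u) w₁ w₂) ((if b then w₂ else w₁).psubst 0 u)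
  | edestPair {m u v} : Step (.edest (.epair m u) v) ((v.tsubst 0 m).psubst 0 u)
  -- redexes for the constant-domain axiom
  | DinjL {A B u} : Step (.app (.D A B) (.qlam (.inj false u))) (.inj false (.qlam u))
  | DinjR {A B u} : Step (.app (.D A B) (.qlam (.inj true u))) (.inj true (u.tsubst 0 (.const 0)))
  -- congruence closure
  | pairL {u u' t} : Step u u' → Step (.pair u t) (.pair u' t)
  | pairR {u t t'} : Step t t' → Step (.pair u t) (.pair u t')
  | projC {b u u'} : Step u u' → Step (.proj b u) (.proj b u')
  | lamC {A u u'} : Step u u' → Step (.lam A u) (.lam A u')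
  | appL {u u' t} : Step u u' → Step (.app u t) (.app u' t)
  | appR {u t t'} : Step t t' → Step (.app u t) (.app u t')
  | injC {b u u'} : Step u u' → Step (.inj b u) (.inj b u')
  | caseU {u u' w₁ w₂} : Step u u' → Step (.case u w₁ w₂) (.case u' w₁ w₂)
  | caseL {u w₁ w₁' w₂} : Step w₁ w₁' → Step (.case u w₁ w₂) (.case u w₁' w₂)
  | caseR {u w₁ w₂ w₂'} : Step w₂ w₂' → Step (.case u w₁ w₂) (.case u w₁ w₂')
  | qlamC {u u'} : Step u u' → Step (.qlam u) (.qlam u')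
  | qappC {u u' m} : Step u u' → Step (.qapp u m) (.qapp u' m)
  | epairC {m u u'} : Step u u' → Step (.epair m u) (.epair m u')
  | edestL {u u' v} : Step u u' → Step (.edest u v) (.edest u' v)
  | edestR {u v v'} : Step v v' → Step (.edest u v) (.edest u v')
  | efqC {P u u'} : Step u u' → Step (.efq P u) (.efq P u')

/-- A proof term is normal if no reduction applies to it. -/
def NormalForm (t : Pf) : Prop := ∀ u, ¬ Step t u

/-! The proof uses Aczel's slash: a predicate `Slash σ A` on formulas `A` under a simultaneous
substitution `σ`, which implies provability of `A` under `σ`, holds of every provable formula, and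
at an existential formula supplies a witness. -/

namespace Tm

theorem induction_list {P : Tm → Prop} (var : ∀ i, P (.var i)) (const : ∀ k, P (.const k))
    (func : ∀ f ts, (∀ t ∈ ts, P t) → P (.func f ts)) : ∀ t, P t
  | .var i => var i
  | .const k => const k
  | .func f ts => func f ts fun t _ht => induction_list var const func t
termination_by t => sizeOf t
decreasing_by have := List.sizeOf_lt_of_mem _ht; simp; omega

/-- Simultaneous substitution. -/
def bind (σ : ℕ → Tm) : Tm → Tm
  | var i => σ i
  | const k => const k
  | func f ts => func f (ts.attach.map fun x => bind σ x.1)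
termination_by t => sizeOf t
decreasing_by have := List.sizeOf_lt_of_mem x.2; simp; omega

@[simp] theorem bind_var (σ : ℕ → Tm) (i : ℕ) : (var i).bind σ = σ i := by rw [bind]

@[simp] theorem bind_const (σ : ℕ → Tm) (k : ℕ) : (const k).bind σ = const k := by rw [bind]

@[simp] theorem bind_func (σ : ℕ → Tm) (f : ℕ) (ts : List Tm) :
    (func f ts).bind σ = func f (ts.map (bind σ)) := by
  rw [bind, List.attach_map_val]

theorem lift_eq_bind (d c : ℕ) (t : Tm) :
    t.lift d c = t.bind fun i => if i < c then var i else var (i + d) := by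
  induction t using induction_list with
  | var i => simp [lift]
  | const k => simp [lift]
  | func f ts ih =>
    rw [lift, List.attach_map_val (f := lift d c), bind_func, List.map_congr_left ih]

theorem subst_eq_bind (k : ℕ) (m t : Tm) :
    subst k m t = t.bind fun i => if i = k then m else if i < k then var i else var (i - 1) := by
  induction t using induction_list with
  | var i => simp [subst]
  | const k => simp [subst]
  | func f ts ih =>
    rw [subst, List.attach_map_val (f := subst k m), bind_func, List.map_congr_left ih]

theorem bind_bind (σ τ : ℕ → Tm) (t : Tm) :
    (t.bind σ).bind τ = t.bind fun i => (σ i).bind τ := by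
  induction t using induction_list with
  | var i => simp
  | const k => simp
  | func f ts ih => simpa using ih

theorem bind_id (t : Tm) : t.bind var = t := by
  induction t using induction_list with
  | var i => simp
  | const k => simp
  | func f ts ih => simpa using List.map_congr_left (g := id) ih

/-- The action of a substitution under a binder. -/
def up (σ : ℕ → Tm) : ℕ → Tm
  | 0 => var 0
  | i + 1 => (σ i).bind fun j => var (j + 1)

/-- The substitution sending `0` to `m` and `i + 1` to `σ i`. -/
def cons (m : Tm) (σ : ℕ → Tm) : ℕ → Tm
  | 0 => m
  | i + 1 => σ i

theorem up_bind_up (σ τ : ℕ → Tm) :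
    (fun i => (up σ i).bind (up τ)) = up fun i => (σ i).bind τ := by
  funext i
  cases i <;> simp [up, bind_bind]

theorem up_bind_cons (m : Tm) (σ τ : ℕ → Tm) :
    (fun i => (up σ i).bind (cons m τ)) = cons m fun i => (σ i).bind τ := by
  funext i
  cases i <;> simp [up, cons, bind_bind]

theorem up_var : up var = var := by
  funext i
  cases i <;> simp [up]

theorem up_lift (d c : ℕ) :
    (up fun i => if i < c then var i else var (i + d)) =
      fun i => if i < c + 1 then var i else var (i + d) := by
  funext i
  cases i with
  | zero => simp [up]
  | succ i =>
    by_cases h : i < c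
    · simp [up, h]
    · simp [up, h, Nat.add_right_comm]

theorem up_subst (k : ℕ) (m : Tm) :
    (up fun i => if i = k then m else if i < k then var i else var (i - 1)) =
      fun i => if i = k + 1 then m.lift 1 0 else if i < k + 1 then var i else var (i - 1) := by
  funext i
  cases i with
  | zero => simp [up]
  | succ i =>
    rcases lt_trichotomy i k with h | h | h
    · simp [up, h, h.ne]
    · simp [up, h, lift_eq_bind]
    · have h1 : ¬ i < k := h.not_gt
      have h2 : i - 1 + 1 = i := by omega
      simp [up, h1, h.ne', h2]

theorem exists_bind_congr (t : Tm) :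
    ∃ N, ∀ σ τ : ℕ → Tm, (∀ i < N, σ i = τ i) → t.bind σ = t.bind τ := by
  induction t using induction_list with
  | var i => exact ⟨i + 1, fun σ τ h => by simpa using h i (by omega)⟩
  | const k => exact ⟨0, by simp⟩
  | func f ts ih =>
    suffices ∃ N, ∀ σ τ : ℕ → Tm, (∀ i < N, σ i = τ i) → ∀ t ∈ ts, t.bind σ = t.bind τ by
      simpa using this
    choose! N hN using ih
    refine ⟨(ts.map N).sum, fun σ τ h t ht => hN t ht σ τ fun i hi => h i ?_⟩
    exact hi.trans_le (List.single_le_sum (by simp) _ (List.mem_map_of_mem ht))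

end Tm

namespace Fml

/-- Simultaneous substitution. -/
def bind : (ℕ → Tm) → Fml → Fml
  | σ, atom P ts => atom P (ts.map (Tm.bind σ))
  | _, bot => bot
  | σ, conj A B => conj (bind σ A) (bind σ B)
  | σ, disj A B => disj (bind σ A) (bind σ B)
  | σ, impl A B => impl (bind σ A) (bind σ B)
  | σ, all A => all (bind (Tm.up σ) A)
  | σ, ex A => ex (bind (Tm.up σ) A)

theorem lift_eq_bind (d c : ℕ) (A : Fml) :
    A.lift d c = A.bind fun i => if i < c then .var i else .var (i + d) := by
  induction A generalizing c <;> simp_all [lift, bind, Tm.up_lift, Tm.lift_eq_bind]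

theorem subst_eq_bind (k : ℕ) (m : Tm) (A : Fml) :
    A.subst k m =
      A.bind fun i => if i = k then m else if i < k then .var i else .var (i - 1) := by
  induction A generalizing k m <;> simp_all [subst, bind, Tm.up_subst, Tm.subst_eq_bind]

theorem lift_one (A : Fml) : A.lift 1 0 = A.bind fun i => .var (i + 1) := by
  simp [lift_eq_bind]

theorem subst_zero (m : Tm) (A : Fml) : A.subst 0 m = A.bind (Tm.cons m .var) := by
  rw [subst_eq_bind]
  congr 1
  funext i
  cases i <;> simp [Tm.cons]

theorem bind_bind (σ τ : ℕ → Tm) (A : Fml) :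
    (A.bind σ).bind τ = A.bind fun i => (σ i).bind τ := by
  induction A generalizing σ τ <;> simp_all [bind, Tm.bind_bind, Tm.up_bind_up]

theorem bind_id (A : Fml) : A.bind .var = A := by
  induction A <;> simp_all [bind, Tm.up_var]
  exact List.map_id'' Tm.bind_id _

theorem lift_one_bind_cons (m : Tm) (σ : ℕ → Tm) (A : Fml) :
    (A.lift 1 0).bind (Tm.cons m σ) = A.bind σ := by
  simp [lift_one, bind_bind, Tm.cons]

theorem lift_one_bind_up (σ : ℕ → Tm) (A : Fml) :
    (A.lift 1 0).bind (Tm.up σ) = (A.bind σ).lift 1 0 := by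
  simp [lift_one, bind_bind, Tm.up]

theorem bind_up_subst_zero (m : Tm) (σ : ℕ → Tm) (A : Fml) :
    (A.bind (Tm.up σ)).subst 0 m = A.bind (Tm.cons m σ) := by
  simp [subst_zero, bind_bind, Tm.up_bind_cons, Tm.bind_id]

theorem cons_var_bind (m : Tm) (σ : ℕ → Tm) :
    (fun i => (Tm.cons m .var i).bind σ) = Tm.cons (m.bind σ) σ := by
  funext i
  cases i <;> simp [Tm.cons]

theorem subst_zero_bind (m : Tm) (σ : ℕ → Tm) (A : Fml) :
    (A.subst 0 m).bind σ = (A.bind (Tm.up σ)).subst 0 (m.bind σ) := by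
  rw [bind_up_subst_zero, subst_zero, bind_bind, cons_var_bind]

theorem Atomic.bind {A : Fml} (h : A.Atomic) (σ : ℕ → Tm) : (A.bind σ).Atomic := by
  cases A <;> simp_all [Atomic, Fml.bind]

theorem exists_bind_congr (A : Fml) :
    ∃ N, ∀ σ τ : ℕ → Tm, (∀ i < N, σ i = τ i) → A.bind σ = A.bind τ := by
  have binary {A B : Fml} (hA : ∃ N, ∀ σ τ : ℕ → Tm, (∀ i < N, σ i = τ i) → A.bind σ = A.bind τ)
      (hB : ∃ N, ∀ σ τ : ℕ → Tm, (∀ i < N, σ i = τ i) → B.bind σ = B.bind τ) :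
      ∃ N, ∀ σ τ : ℕ → Tm, (∀ i < N, σ i = τ i) → A.bind σ = A.bind τ ∧ B.bind σ = B.bind τ := by
    obtain ⟨N, hN⟩ := hA
    obtain ⟨M, hM⟩ := hB
    exact ⟨N + M, fun σ τ h =>
      ⟨hN _ _ fun i hi => h i (by omega), hM _ _ fun i hi => h i (by omega)⟩⟩
  have binder {A : Fml} (hA : ∃ N, ∀ σ τ : ℕ → Tm, (∀ i < N, σ i = τ i) → A.bind σ = A.bind τ) :
      ∃ N, ∀ σ τ : ℕ → Tm, (∀ i < N, σ i = τ i) → A.bind (Tm.up σ) = A.bind (Tm.up τ) := by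
    obtain ⟨N, hN⟩ := hA
    refine ⟨N, fun σ τ h => hN _ _ fun i hi => ?_⟩
    cases i with
    | zero => rfl
    | succ i => simp [Tm.up, h i (by omega)]
  induction A with
  | atom P ts =>
    obtain ⟨N, hN⟩ := Tm.exists_bind_congr (.func P ts)
    exact ⟨N, by simpa [bind] using hN⟩
  | bot => exact ⟨0, by simp [bind]⟩
  | conj A B ihA ihB => simpa [bind] using binary ihA ihB
  | disj A B ihA ihB => simpa [bind] using binary ihA ihB
  | impl A B ihA ihB => simpa [bind] using binary ihA ihB
  | all A ih => simpa [bind] using binder ih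
  | ex A ih => simpa [bind] using binder ih

end Fml

/-- Derivability of `A` from the context `Γ`. -/
def Derivable (Γ : List Fml) (A : Fml) : Prop := ∃ t, Typed Γ t A

theorem Typed.derivable_of_subset {Γ : List Fml} {t : Pf} {A : Fml} (h : Typed Γ t A) :
    ∀ {Δ : List Fml}, Γ ⊆ Δ → Derivable Δ A := by
  induction h with
  | var h =>
    intro Δ hΔ
    obtain ⟨n, hn⟩ := List.mem_iff_getElem?.1 (hΔ (List.mem_of_getElem? h))
    exact ⟨_, .var hn⟩
  | pair _ _ ih₁ ih₂ => exact fun hΔ => ⟨_, .pair (ih₁ hΔ).choose_spec (ih₂ hΔ).choose_spec⟩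
  | projL _ ih => exact fun hΔ => ⟨_, .projL (ih hΔ).choose_spec⟩
  | projR _ ih => exact fun hΔ => ⟨_, .projR (ih hΔ).choose_spec⟩
  | lam _ ih => exact fun hΔ => ⟨_, .lam (ih (List.cons_subset_cons _ hΔ)).choose_spec⟩
  | app _ _ ih₁ ih₂ => exact fun hΔ => ⟨_, .app (ih₁ hΔ).choose_spec (ih₂ hΔ).choose_spec⟩
  | injL _ ih => exact fun hΔ => ⟨_, .injL (ih hΔ).choose_spec⟩
  | injR _ ih => exact fun hΔ => ⟨_, .injR (ih hΔ).choose_spec⟩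
  | case _ _ _ ih₁ ih₂ ih₃ =>
    exact fun hΔ => ⟨_, .case (ih₁ hΔ).choose_spec (ih₂ (List.cons_subset_cons _ hΔ)).choose_spec
      (ih₃ (List.cons_subset_cons _ hΔ)).choose_spec⟩
  | qlam _ ih => exact fun hΔ => ⟨_, .qlam (ih (List.map_subset _ hΔ)).choose_spec⟩
  | qapp m _ ih => exact fun hΔ => ⟨_, .qapp m (ih hΔ).choose_spec⟩
  | epair m _ ih => exact fun hΔ => ⟨_, .epair m (ih hΔ).choose_spec⟩
  | edest _ _ ih₁ ih₂ =>
    exact fun hΔ => ⟨_, .edest (ih₁ hΔ).choose_spec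
      (ih₂ (List.cons_subset_cons _ (List.map_subset _ hΔ))).choose_spec⟩
  | efq _ hP ih => exact fun hΔ => ⟨_, .efq (ih hΔ).choose_spec hP⟩
  | D => exact fun _ => ⟨_, .D⟩

theorem map_lift_one_map_bind_up (σ : ℕ → Tm) (Γ : List Fml) :
    (Γ.map (Fml.lift 1 0)).map (Fml.bind (Tm.up σ)) =
      (Γ.map (Fml.bind σ)).map (Fml.lift 1 0) := by
  simp [Fml.lift_one_bind_up]

theorem Typed.derivable_bind {Γ : List Fml} {t : Pf} {A : Fml} (h : Typed Γ t A) :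
    ∀ σ : ℕ → Tm, Derivable (Γ.map (Fml.bind σ)) (A.bind σ) := by
  induction h with
  | @var Γ n A h => exact fun σ => ⟨.var n, .var (by simp [h])⟩
  | pair _ _ ih₁ ih₂ => exact fun σ => ⟨_, .pair (ih₁ σ).choose_spec (ih₂ σ).choose_spec⟩
  | projL _ ih => exact fun σ => ⟨_, .projL (ih σ).choose_spec⟩
  | projR _ ih => exact fun σ => ⟨_, .projR (ih σ).choose_spec⟩
  | lam _ ih => exact fun σ => ⟨_, .lam (ih σ).choose_spec⟩
  | app _ _ ih₁ ih₂ => exact fun σ => ⟨_, .app (ih₁ σ).choose_spec (ih₂ σ).choose_spec⟩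
  | injL _ ih => exact fun σ => ⟨_, .injL (ih σ).choose_spec⟩
  | injR _ ih => exact fun σ => ⟨_, .injR (ih σ).choose_spec⟩
  | case _ _ _ ih₁ ih₂ ih₃ =>
    exact fun σ => ⟨_, .case (ih₁ σ).choose_spec (ih₂ σ).choose_spec (ih₃ σ).choose_spec⟩
  | qlam _ ih =>
    intro σ
    obtain ⟨t, ht⟩ := ih (Tm.up σ)
    rw [map_lift_one_map_bind_up] at ht
    exact ⟨_, .qlam ht⟩
  | qapp m _ ih =>
    intro σ
    rw [Fml.subst_zero_bind]
    exact ⟨_, .qapp _ (ih σ).choose_spec⟩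
  | epair m _ ih =>
    intro σ
    obtain ⟨t, ht⟩ := ih σ
    rw [Fml.subst_zero_bind] at ht
    exact ⟨_, .epair _ ht⟩
  | edest _ _ ih₁ ih₂ =>
    intro σ
    obtain ⟨t, ht⟩ := ih₂ (Tm.up σ)
    rw [List.map_cons, map_lift_one_map_bind_up, Fml.lift_one_bind_up] at ht
    exact ⟨_, .edest (ih₁ σ).choose_spec ht⟩
  | efq _ hP ih => exact fun σ => ⟨_, .efq (ih σ).choose_spec (hP.bind σ)⟩
  | D =>
    intro σ
    simp only [Fml.bind, Fml.lift_one_bind_up]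
    exact ⟨_, .D⟩

theorem Derivable.cut {Γ : List Fml} {A : Fml} (h : Derivable Γ A)
    (hΓ : ∀ B ∈ Γ, Derivable [] B) : Derivable [] A := by
  induction Γ generalizing A with
  | nil => exact h
  | cons B Γ ih =>
    obtain ⟨t, ht⟩ := h
    obtain ⟨u, hu⟩ := ih ⟨_, .lam ht⟩ fun C hC => hΓ C (List.mem_cons_of_mem _ hC)
    obtain ⟨v, hv⟩ := hΓ B List.mem_cons_self
    exact ⟨_, .app hu hv⟩

theorem derivable_all_of_forall_subst {A : Fml} (h : ∀ m, Derivable [] (A.subst 0 m)) :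
    Derivable [] (.all A) := by
  obtain ⟨N, hN⟩ := A.exists_bind_congr
  obtain ⟨t, ht⟩ := h (.var N)
  obtain ⟨u, hu⟩ := ht.derivable_bind fun i => if i = N then .var 0 else .var (i + 1)
  rw [Fml.subst_zero, Fml.bind_bind, ← hN .var, A.bind_id] at hu
  · exact ⟨_, .qlam hu⟩
  intro i hi
  cases i with
  | zero => simp [Tm.cons]
  | succ i =>
    have : i ≠ N := by omega
    simp [Tm.cons, this]

/-- Aczel's slash for the formula `A` under the substitution `σ`. -/
def Slash : (ℕ → Tm) → Fml → Prop
  | σ, .atom P ts => Derivable [] ((Fml.atom P ts).bind σ)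
  | _, .bot => Derivable [] .bot
  | σ, .conj A B => Slash σ A ∧ Slash σ B
  | σ, .disj A B => Slash σ A ∨ Slash σ B
  | σ, .impl A B => Derivable [] ((Fml.impl A B).bind σ) ∧ (Slash σ A → Slash σ B)
  | σ, .all A => Derivable [] ((Fml.all A).bind σ) ∧ ∀ m, Slash (Tm.cons m σ) A
  | σ, .ex A => ∃ m, Slash (Tm.cons m σ) A

theorem Slash.derivable {σ : ℕ → Tm} {A : Fml} (h : Slash σ A) : Derivable [] (A.bind σ) := by
  induction A generalizing σ with
  | atom P ts => exact h
  | bot => exact h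
  | conj A B ihA ihB => exact ⟨_, .pair (ihA h.1).choose_spec (ihB h.2).choose_spec⟩
  | disj A B ihA ihB =>
    rcases h with h | h
    · exact ⟨_, .injL (ihA h).choose_spec⟩
    · exact ⟨_, .injR (ihB h).choose_spec⟩
  | impl A B => exact h.1
  | all A => exact h.1
  | ex A ih =>
    obtain ⟨m, hm⟩ := h
    obtain ⟨t, ht⟩ := ih hm
    rw [← Fml.bind_up_subst_zero] at ht
    exact ⟨_, .epair m ht⟩

theorem slash_bind (σ τ : ℕ → Tm) (A : Fml) :
    Slash τ (A.bind σ) ↔ Slash (fun i => (σ i).bind τ) A := by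
  induction A generalizing σ τ with
  | atom P ts =>
    change Derivable [] (((Fml.atom P ts).bind σ).bind τ) ↔ _
    rw [Fml.bind_bind]
    rfl
  | bot => rfl
  | conj A B ihA ihB => simp [Fml.bind, Slash, ihA, ihB]
  | disj A B ihA ihB => simp [Fml.bind, Slash, ihA, ihB]
  | impl A B ihA ihB => simp [Fml.bind, Slash, ihA, ihB, Fml.bind_bind]
  | all A ih => simp [Fml.bind, Slash, ih, Fml.bind_bind, Tm.up_bind_up, Tm.up_bind_cons]
  | ex A ih => simp [Fml.bind, Slash, ih, Tm.up_bind_cons]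

theorem slash_lift_one (m : Tm) (σ : ℕ → Tm) (A : Fml) :
    Slash (Tm.cons m σ) (A.lift 1 0) ↔ Slash σ A := by
  simp [Fml.lift_one, slash_bind, Tm.cons]

theorem slash_subst_zero (m : Tm) (σ : ℕ → Tm) (A : Fml) :
    Slash σ (A.subst 0 m) ↔ Slash (Tm.cons (m.bind σ) σ) A := by
  rw [Fml.subst_zero, slash_bind, Fml.cons_var_bind]

theorem slash_constant_domain {σ : ℕ → Tm} {A B : Fml}
    (h : Slash σ (.all (.disj A (B.lift 1 0)))) : Slash σ (.disj (.all A) B) := by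
  by_cases hB : Slash σ B
  · exact .inr hB
  have hA (m : Tm) : Slash (Tm.cons m σ) A :=
    (h.2 m).resolve_right fun h => hB ((slash_lift_one m σ B).1 h)
  refine .inl ⟨derivable_all_of_forall_subst fun m => ?_, hA⟩
  rw [Fml.bind_up_subst_zero]
  exact (hA m).derivable

theorem Typed.slash {Γ : List Fml} {t : Pf} {A : Fml} (h : Typed Γ t A) :
    ∀ σ : ℕ → Tm, (∀ B ∈ Γ, Slash σ B) → Slash σ A := by
  have closed {Γ : List Fml} {t : Pf} {A : Fml} (h : Typed Γ t A) (σ : ℕ → Tm)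
      (hΓ : ∀ B ∈ Γ, Slash σ B) : Derivable [] (A.bind σ) :=
    (h.derivable_bind σ).cut (by simpa using fun B hB => (hΓ B hB).derivable)
  have lifted {Γ : List Fml} {σ : ℕ → Tm} (hΓ : ∀ B ∈ Γ, Slash σ B) (m : Tm) :
      ∀ B ∈ Γ.map (Fml.lift 1 0), Slash (Tm.cons m σ) B := by
    simpa [slash_lift_one] using hΓ
  induction h with
  | var h => exact fun σ hΓ => hΓ _ (List.mem_of_getElem? h)
  | pair _ _ ih₁ ih₂ => exact fun σ hΓ => ⟨ih₁ σ hΓ, ih₂ σ hΓ⟩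
  | projL _ ih => exact fun σ hΓ => (ih σ hΓ).1
  | projR _ ih => exact fun σ hΓ => (ih σ hΓ).2
  | lam hu ih =>
    exact fun σ hΓ => ⟨closed (.lam hu) σ hΓ, fun hA => ih σ (List.forall_mem_cons.2 ⟨hA, hΓ⟩)⟩
  | app _ _ ih₁ ih₂ => exact fun σ hΓ => (ih₁ σ hΓ).2 (ih₂ σ hΓ)
  | injL _ ih => exact fun σ hΓ => .inl (ih σ hΓ)
  | injR _ ih => exact fun σ hΓ => .inr (ih σ hΓ)
  | case _ _ _ ih₁ ih₂ ih₃ =>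
    intro σ hΓ
    rcases ih₁ σ hΓ with h | h
    · exact ih₂ σ (List.forall_mem_cons.2 ⟨h, hΓ⟩)
    · exact ih₃ σ (List.forall_mem_cons.2 ⟨h, hΓ⟩)
  | qlam hu ih => exact fun σ hΓ => ⟨closed (.qlam hu) σ hΓ, fun m => ih _ (lifted hΓ m)⟩
  | qapp m _ ih => exact fun σ hΓ => (slash_subst_zero _ _ _).2 ((ih σ hΓ).2 _)
  | epair m _ ih => exact fun σ hΓ => ⟨_, (slash_subst_zero _ _ _).1 (ih σ hΓ)⟩
  | edest _ _ ih₁ ih₂ =>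
    intro σ hΓ
    obtain ⟨m, hm⟩ := ih₁ σ hΓ
    exact (slash_lift_one m σ _).1 (ih₂ _ (List.forall_mem_cons.2 ⟨hm, lifted hΓ m⟩))
  | @efq Γ u P hu hP ih =>
    intro σ hΓ
    have := closed (.efq hu hP) σ hΓ
    cases P <;> first | exact this | exact hP.elim
  | D => exact fun σ hΓ => ⟨closed .D σ hΓ, slash_constant_domain⟩

/-- **Witness (existence) property of CD**: if `∃α A` is provable in CD (there
is a closed proof term `t` with `CD ⊢ t : ∃α A`), then there is a term `m` of
the first-order language such that `A[m/α]` is provable in CD. -/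
theorem witness_property {A : Fml}
    (h : ∃ t : Pf, Typed [] t (.ex A)) :
    ∃ (m : Tm) (u : Pf), Typed [] u (A.subst 0 m) := by
  obtain ⟨t, ht⟩ := h
  obtain ⟨m, hm⟩ := ht.slash .var (by simp)
  obtain ⟨u, hu⟩ := hm.derivable
  rw [← Fml.subst_zero] at hu
  exact ⟨m, u, hu⟩
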